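/- Let p ∈ (0,1) and define a sequence of nonnegative integers k₁, k₂, … recursively by: kᵢ is the largest nonnegative integer such that ∏_{j=1}^{i} (1 − 2^{−j})^{k_j} ≥ p (with k₁,…,k_{i−1} already fixed). Then k₁ = ⌊log₂(1/p)⌋, and k_j ≤ 3 for every j ≥ 2. -/

import Mathlib

/-- The greedy condition defining the sequence `k`: for each `i ≥ 1`, `k i` is the largest
nonnegative integer such that `∏_{j=1}^{i} (1 - 2^{-j})^{k j} ≥ p` (with `k 1, …, k (i-1)`
already fixed); equivalently, the product with exponents `k 1, …, k i` is at least `p`,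
while increasing the exponent `k i` by one would make the product drop below `p`. -/
def GreedySeq (p : ℝ) (k : ℕ → ℕ) : Prop :=
  ∀ i : ℕ, 1 ≤ i →
    p ≤ (∏ j ∈ Finset.Icc 1 i, (1 - (2 : ℝ) ^ (-(j : ℤ))) ^ (k j)) ∧
    (∏ j ∈ Finset.Icc 1 i, (1 - (2 : ℝ) ^ (-(j : ℤ))) ^ (k j)) *
        (1 - (2 : ℝ) ^ (-(i : ℤ))) < p

theorem GreedySeq.le_three {p : ℝ} (hp0 : 0 < p) {k : ℕ → ℕ} (hk : GreedySeq p k)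
    {j : ℕ} (hj : 2 ≤ j) : k j ≤ 3 := by
  obtain ⟨i, rfl⟩ : ∃ i, j = i + 1 := ⟨j - 1, by omega⟩
  have hprev := (hk i (by omega)).2
  have hle := (hk (i + 1) (by omega)).1
  rw [Finset.prod_Icc_succ_top (by omega)] at hle
  set P := ∏ j ∈ Finset.Icc 1 i, (1 - (2 : ℝ) ^ (-(j : ℤ))) ^ (k j)
  set x : ℝ := (2 : ℝ) ^ (-((i + 1 : ℕ) : ℤ)) with hx
  have hx0 : 0 < x := by positivity
  have hx4 : x ≤ 1 / 4 := by
    calc x ≤ (2 : ℝ) ^ (-2 : ℤ) := zpow_le_zpow_right₀ (by norm_num) (by omega)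
      _ = 1 / 4 := by norm_num
  have hx2 : (2 : ℝ) ^ (-(i : ℤ)) = 2 * x := by
    rw [hx, ← zpow_one_add₀ (by norm_num)]
    congr 1
    push_cast
    ring
  rw [hx2] at hprev
  by_contra! h
  have hpow : (1 - x) ^ k (i + 1) ≤ 1 - 2 * x :=
    calc (1 - x) ^ k (i + 1) ≤ (1 - x) ^ 3 :=
          pow_le_pow_of_le_one (by linarith) (by linarith) (by omega)
      _ ≤ 1 - 2 * x := by nlinarith [mul_nonneg hx0.le (sq_nonneg x)]
  have hP : 0 < P :=
    pos_of_mul_pos_left (hp0.trans_le hle) (pow_nonneg (by linarith) _)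
  linarith [mul_le_mul_of_nonneg_left hpow hP.le]

theorem GreedySeq.apply_one {p : ℝ} (hp0 : 0 < p) {k : ℕ → ℕ} (hk : GreedySeq p k) :
    k 1 = Nat.floor (Real.logb 2 (1 / p)) := by
  obtain ⟨hle, hlt⟩ := hk 1 le_rfl
  have hhalf : (1 - (2 : ℝ) ^ (-((1 : ℕ) : ℤ))) = 2⁻¹ := by norm_num
  rw [Finset.Icc_self, Finset.prod_singleton, hhalf, inv_pow] at hle hlt
  rw [← mul_inv, ← pow_succ] at hlt
  have hlower : (k 1 : ℝ) ≤ Real.logb 2 (1 / p) := by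
    rw [Real.le_logb_iff_rpow_le (by norm_num) (by positivity), Real.rpow_natCast, one_div]
    exact (le_inv_comm₀ hp0 (by positivity)).1 hle
  refine ((Nat.floor_eq_iff ((Nat.cast_nonneg _).trans hlower)).2 ⟨hlower, ?_⟩).symm
  rw [Real.logb_lt_iff_lt_rpow (by norm_num) (by positivity), one_div]
  exact_mod_cast (inv_lt_comm₀ (by positivity) hp0).1 hlt

theorem stmt_18 (p : ℝ) (hp0 : 0 < p) (hp1 : p < 1) (k : ℕ → ℕ)
    (hk : GreedySeq p k) :
    k 1 = Nat.floor (Real.logb 2 (1 / p)) ∧ ∀ j : ℕ, 2 ≤ j → k j ≤ 3 :=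
  ⟨hk.apply_one hp0, fun _ hj => hk.le_three hp0 hj⟩
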